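/- Let 𝒜 be a semi-abelian category and f: X→Y a central extension with kernel k: K→X. Then for every monomorphism i: M→K, the composite k∘i: M→X is a normal monomorphism of 𝒜, i.e., it is a kernel of some morphism of 𝒜. -/

import Mathlib

open CategoryTheory CategoryTheory.Limits

universe v u

section Defs

variable {C : Type u} [Category.{v} C]

/-- A finitely complete category is protomodular if, for every commutative diagram of two
adjacent commutative squares in which the middle vertical morphism is a split epimorphism,
whenever the left-hand square and the outer rectangle are pullbacks, so is the right-hand
square. -/
def Protomodular (C : Type u) [Category.{v} C] : Prop :=
  ∀ ⦃A B D A' B' D' : C⦄ (f : A ⟶ B) (g : B ⟶ D)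
    (f' : A' ⟶ B') (g' : B' ⟶ D')
    (a : A ⟶ A') (b : B ⟶ B') (d : D ⟶ D'),
    g ≫ d = b ≫ g' →
    IsSplitEpi b →
    IsPullback f a b f' →
    IsPullback (f ≫ g) a d (f' ≫ g') →
    IsPullback g b d g'

variable [HasZeroMorphisms C] [HasFiniteLimits C]

/-- Two coterminal morphisms `k`, `k'` cooperate (commute in the sense of Huq) when there is
a morphism `φ : K ⨯ K' ⟶ X` restricting to `k` and `k'` along `(1,0)` and `(0,1)`. -/
def Cooperate {K K' X : C} (k : K ⟶ X) (k' : K' ⟶ X) : Prop :=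
  ∃ φ : K ⨯ K' ⟶ X, prod.lift (𝟙 K) 0 ≫ φ = k ∧ prod.lift 0 (𝟙 K') ≫ φ = k'

/-- A morphism is central in the sense of Huq when it cooperates with the identity. -/
def HuqCentral {K X : C} (k : K ⟶ X) : Prop :=
  Cooperate k (𝟙 X)

/-- An object is abelian when its identity cooperates with itself. -/
def IsAbelianObj (A : C) : Prop :=
  Cooperate (𝟙 A) (𝟙 A)

/-- `k` is a kernel of `f`. -/
def IsKernelOf {K X Y : C} (k : K ⟶ X) (f : X ⟶ Y) : Prop :=
  ∃ w : k ≫ f = 0, Nonempty (IsLimit (KernelFork.ofι k w))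

/-- A central extension is a regular epimorphism whose kernel is Huq-central. -/
def IsCentralExt {X Y : C} (f : X ⟶ Y) : Prop :=
  Nonempty (RegularEpi f) ∧ HuqCentral (kernel.ι f)

/-- A normal monomorphism: a morphism that is a kernel of some morphism. -/
def IsNormalMonoP {K X : C} (m : K ⟶ X) : Prop :=
  ∃ (Z : C) (g : X ⟶ Z), IsKernelOf m g

/-- `(p₁, p₂) : R ↣ X ⨯ X` is an internal equivalence relation. -/
structure IsEquivRelation {R X : C} (p₁ p₂ : R ⟶ X) : Prop where
  mono : Mono (prod.lift p₁ p₂)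
  refl : ∃ d : X ⟶ R, d ≫ p₁ = 𝟙 X ∧ d ≫ p₂ = 𝟙 X
  symm : ∃ s : R ⟶ R, s ≫ p₁ = p₂ ∧ s ≫ p₂ = p₁
  trans : ∃ t : pullback p₂ p₁ ⟶ R,
    t ≫ p₁ = pullback.fst p₂ p₁ ≫ p₁ ∧ t ≫ p₂ = pullback.snd p₂ p₁ ≫ p₂

end Defs

/-- A semi-abelian category: pointed, Barr-exact (regular with effective equivalence
relations), protomodular and with binary coproducts. -/
class SemiAbelian (C : Type u) [Category.{v} C] [HasZeroMorphisms C] [HasZeroObject C]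
    [HasFiniteLimits C] [HasBinaryCoproducts C] : Prop where
  /-- Every kernel pair has a coequalizer. -/
  hasCoeqOfKernelPair : ∀ {X Y : C} (f : X ⟶ Y),
    HasCoequalizer (pullback.fst f f) (pullback.snd f f)
  /-- Regular epimorphisms are stable under pullback. -/
  regEpiPullbackStable : ∀ {X Y Z : C} (f : X ⟶ Z) (g : Y ⟶ Z),
    Nonempty (RegularEpi g) → Nonempty (RegularEpi (pullback.fst f g))
  /-- Every internal equivalence relation is effective, i.e. a kernel pair. -/
  equivRelationEffective : ∀ {R X : C} (p₁ p₂ : R ⟶ X), IsEquivRelation p₁ p₂ →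
    ∃ (Y : C) (f : X ⟶ Y), IsKernelPair f p₁ p₂
  /-- The category is protomodular. -/
  protomodular : Protomodular C

open scoped ZeroObject

attribute [local simp] prod.lift_fst prod.lift_snd prod.lift_fst_assoc prod.lift_snd_assoc

section Protomodularity

variable {C : Type u} [Category.{v} C] [HasZeroMorphisms C]

theorem isKernelOf_of_mono {K X Y : C} {k : K ⟶ X} {f : X ⟶ Y} [Mono k] (w : k ≫ f = 0)
    (h : ∀ {T : C} (t : T ⟶ X), t ≫ f = 0 → ∃ l : T ⟶ K, l ≫ k = t) : IsKernelOf k f :=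
  ⟨w, ⟨KernelFork.IsLimit.ofι k w (fun t ht => (h t ht).choose)
    (fun t ht => (h t ht).choose_spec)
    (fun t ht _ hl => by rw [← cancel_mono k, hl, (h t ht).choose_spec])⟩⟩

theorem IsKernelOf.mono {K X Y : C} {k : K ⟶ X} {f : X ⟶ Y} (h : IsKernelOf k f) : Mono k := by
  obtain ⟨w, ⟨hl⟩⟩ := h
  exact ⟨fun a b hab => Fork.IsLimit.hom_ext hl hab⟩

theorem IsKernelOf.exists_lift {K X Y T : C} {k : K ⟶ X} {f : X ⟶ Y} (h : IsKernelOf k f)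
    (t : T ⟶ X) (ht : t ≫ f = 0) : ∃ l : T ⟶ K, l ≫ k = t := by
  obtain ⟨w, ⟨hl⟩⟩ := h
  obtain ⟨l, hl'⟩ := KernelFork.IsLimit.lift' hl t ht
  exact ⟨l, hl'⟩

theorem IsKernelOf.isPullback [HasZeroObject C] {K X Y : C} {k : K ⟶ X} {f : X ⟶ Y}
    (h : IsKernelOf k f) : IsPullback k (0 : K ⟶ 0) f (0 : (0 : C) ⟶ Y) := by
  have := h.mono
  refine ⟨⟨by rw [h.1, zero_comp]⟩, ⟨PullbackCone.IsLimit.mk _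
    (fun s => (h.exists_lift s.fst (by rw [s.condition, comp_zero])).choose)
    (fun s => (h.exists_lift s.fst (by rw [s.condition, comp_zero])).choose_spec)
    (fun s => Subsingleton.elim _ _) (fun s m hm _ => ?_)⟩⟩
  rw [← cancel_mono k, hm,
    (h.exists_lift s.fst (by rw [s.condition, comp_zero])).choose_spec]

/-- A split short five lemma: over a fixed base, a morphism out of a split epimorphism which
preserves the kernel is invertible. -/
theorem Protomodular.isIso [HasZeroObject C] (hC : Protomodular C) {K P Q B : C}
    {k : K ⟶ P} {p : P ⟶ B} {q : Q ⟶ B} [IsSplitEpi p] (u : P ⟶ Q) (hu : u ≫ q = p)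
    (hp : IsKernelOf k p) (hq : IsKernelOf (k ≫ u) q) : IsIso u := by
  have h := hC k u (0 : (0 : C) ⟶ B) (𝟙 B) 0 p q (by rw [hu, Category.comp_id]) inferInstance
    hp.isPullback (by simpa using hq.isPullback)
  exact h.isIso_fst_of_isIso

variable [HasFiniteLimits C]

theorem isKernelOf_prod_snd (A B : C) :
    IsKernelOf (prod.lift (𝟙 A) (0 : A ⟶ B)) (prod.snd : A ⨯ B ⟶ B) := by
  have : Mono (prod.lift (𝟙 A) (0 : A ⟶ B)) :=
    mono_of_mono_fac (prod.lift_fst (𝟙 A) (0 : A ⟶ B))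
  refine isKernelOf_of_mono (prod.lift_snd _ _) fun t ht => ⟨t ≫ prod.fst, ?_⟩
  ext <;> simp [ht]

instance isSplitEpi_prod_snd (A B : C) : IsSplitEpi (prod.snd : A ⨯ B ⟶ B) :=
  ⟨⟨⟨prod.lift 0 (𝟙 B), prod.lift_snd _ _⟩⟩⟩

variable [HasZeroObject C]

/-- The two injections into a product are jointly extremally epimorphic. -/
theorem Protomodular.isIso_of_factors (hC : Protomodular C) {A B S : C} (n : S ⟶ A ⨯ B) [Mono n]
    (h₁ : ∃ a : A ⟶ S, a ≫ n = prod.lift (𝟙 A) 0)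
    (h₂ : ∃ b : B ⟶ S, b ≫ n = prod.lift 0 (𝟙 B)) : IsIso n := by
  obtain ⟨a, ha⟩ := h₁
  obtain ⟨b, hb⟩ := h₂
  have : IsSplitEpi (n ≫ prod.snd) := ⟨⟨⟨b, by rw [reassoc_of% hb, prod.lift_snd]⟩⟩⟩
  have hk := isKernelOf_prod_snd A B
  have := hk.mono
  have : Mono a := mono_of_mono_fac ha
  refine hC.isIso (k := a) (p := n ≫ prod.snd) n rfl ?_ (by rwa [ha])
  refine isKernelOf_of_mono (by rw [reassoc_of% ha, prod.lift_snd]) fun t ht => ?_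
  obtain ⟨l, hl⟩ := hk.exists_lift (t ≫ n) (by rw [Category.assoc, ht])
  exact ⟨l, by rw [← cancel_mono n, Category.assoc, ha, hl]⟩

theorem Protomodular.exists_factor (hC : Protomodular C) {A B S Z : C} (θ : A ⨯ B ⟶ Z)
    (n : S ⟶ Z) [Mono n]
    (h₁ : ∃ a : A ⟶ S, a ≫ n = prod.lift (𝟙 A) 0 ≫ θ)
    (h₂ : ∃ b : B ⟶ S, b ≫ n = prod.lift 0 (𝟙 B) ≫ θ) : ∃ t : A ⨯ B ⟶ S, t ≫ n = θ := by
  obtain ⟨a, ha⟩ := h₁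
  obtain ⟨b, hb⟩ := h₂
  have : IsIso (pullback.fst θ n) := hC.isIso_of_factors _
    ⟨pullback.lift _ a ha.symm, pullback.lift_fst _ _ _⟩
    ⟨pullback.lift _ b hb.symm, pullback.lift_fst _ _ _⟩
  exact ⟨inv (pullback.fst θ n) ≫ pullback.snd θ n, by
    rw [Category.assoc, ← pullback.condition, IsIso.inv_hom_id_assoc]⟩

theorem Protomodular.prod_hom_ext (hC : Protomodular C) {A B Z : C} {g h : A ⨯ B ⟶ Z}
    (h₁ : prod.lift (𝟙 A) 0 ≫ g = prod.lift (𝟙 A) 0 ≫ h)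
    (h₂ : prod.lift 0 (𝟙 B) ≫ g = prod.lift 0 (𝟙 B) ≫ h) : g = h := by
  have : IsIso (equalizer.ι g h) := hC.isIso_of_factors _
    ⟨equalizer.lift _ h₁, equalizer.lift_ι _ _⟩ ⟨equalizer.lift _ h₂, equalizer.lift_ι _ _⟩
  rw [← cancel_epi (equalizer.ι g h), equalizer.condition]

/-- The kernel pair of a morphism with central kernel is given by the projection and the
action of the kernel. -/
theorem Protomodular.isKernelPair_action (hC : Protomodular C) {K X Y : C} {f : X ⟶ Y}
    {k : K ⟶ X} (hk : IsKernelOf k f) {φ : K ⨯ X ⟶ X} (h₁ : prod.lift (𝟙 K) 0 ≫ φ = k)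
    (h₂ : prod.lift 0 (𝟙 X) ≫ φ = 𝟙 X) : IsKernelPair f prod.snd φ := by
  have hφ : (prod.snd : K ⨯ X ⟶ X) ≫ f = φ ≫ f := hC.prod_hom_ext
    (by rw [reassoc_of% h₁, hk.1, prod.lift_snd_assoc, zero_comp])
    (by rw [reassoc_of% h₂, prod.lift_snd_assoc, Category.id_comp])
  have hj : (prod.lift (𝟙 K) 0 ≫ pullback.lift _ _ hφ) ≫ pullback.snd f f = k := by
    rw [Category.assoc, pullback.lift_snd, h₁]
  have hj' : (prod.lift (𝟙 K) 0 ≫ pullback.lift _ _ hφ) ≫ pullback.fst f f = 0 := by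
    rw [Category.assoc, pullback.lift_fst, prod.lift_snd]
  have := hk.mono
  have : Mono (prod.lift (𝟙 K) 0 ≫ pullback.lift _ _ hφ) := mono_of_mono_fac hj
  have : IsIso (pullback.lift _ _ hφ) := by
    refine hC.isIso (q := pullback.fst f f) _ (pullback.lift_fst _ _ _)
      (isKernelOf_prod_snd K X) (isKernelOf_of_mono hj' fun t ht => ?_)
    obtain ⟨l, hl⟩ := hk.exists_lift (t ≫ pullback.snd f f)
      (by rw [Category.assoc, ← pullback.condition, reassoc_of% ht, zero_comp])
    exact ⟨l, pullback.hom_ext (by rw [Category.assoc, hj', ht, comp_zero])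
      (by rw [Category.assoc, hj, hl])⟩
  exact IsPullback.of_iso_pullback ⟨hφ⟩ (asIso (pullback.lift _ _ hφ))
    (pullback.lift_fst _ _ _) (pullback.lift_snd _ _ _)

/-- The action of a subobject of a central kernel is an equivalence relation. -/
theorem Protomodular.isEquivRelation_action (hC : Protomodular C) {K M X Y : C} {f : X ⟶ Y}
    {φ : K ⨯ X ⟶ X} (h₂ : prod.lift 0 (𝟙 X) ≫ φ = 𝟙 X) (hφ : IsKernelPair f prod.snd φ)
    (i : M ⟶ K) [Mono i] :
    IsEquivRelation (prod.snd : M ⨯ X ⟶ X) (prod.map i (𝟙 X) ≫ φ) := by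
  obtain ⟨ρ, hρ⟩ : ∃ ρ, ρ = prod.map i (𝟙 X) ≫ φ := ⟨_, rfl⟩
  rw [← hρ]
  have hρ₂ : prod.lift 0 (𝟙 X) ≫ ρ = 𝟙 X := by
    rw [hρ, prod.lift_map_assoc, zero_comp, Category.comp_id, h₂]
  have hρf : ρ ≫ f = prod.snd ≫ f := by
    rw [hρ, Category.assoc, ← hφ.w, prod.map_snd_assoc, Category.id_comp]
  -- Composing two steps of the action of `M` yields a step of the action of `M`.
  obtain ⟨t, ht⟩ : ∃ t : M ⨯ (M ⨯ X) ⟶ M,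
      prod.lift t (prod.snd ≫ prod.snd) ≫ ρ = prod.map (𝟙 M) ρ ≫ ρ ∧
      prod.lift (𝟙 M) 0 ≫ t = 𝟙 M := by
    have hw : (prod.snd ≫ prod.snd : M ⨯ (M ⨯ X) ⟶ X) ≫ f = (prod.map (𝟙 M) ρ ≫ ρ) ≫ f := by
      rw [Category.assoc, Category.assoc, hρf, prod.map_snd_assoc, hρf]
    have e₁ : prod.lift (𝟙 M) 0 ≫ hφ.lift _ _ hw = prod.lift i 0 := by
      apply hφ.hom_ext
      · simp
      · rw [Category.assoc, hφ.lift_snd, prod.lift_map_assoc, hρ, prod.lift_map_assoc]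
        simp
    have e₂ : prod.lift 0 (𝟙 (M ⨯ X)) ≫ hφ.lift _ _ hw = prod.map i (𝟙 X) := by
      apply hφ.hom_ext
      · simp
      · rw [Category.assoc, hφ.lift_snd, prod.lift_map_assoc, ← hρ]
        have : prod.lift ((0 : M ⨯ X ⟶ M) ≫ 𝟙 M) (𝟙 (M ⨯ X) ≫ ρ)
            = ρ ≫ prod.lift 0 (𝟙 X) := by
          ext <;> simp
        rw [this, Category.assoc, hρ₂, Category.comp_id]
    obtain ⟨t, ht⟩ := hC.exists_factor (hφ.lift _ _ hw ≫ prod.fst) i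
      ⟨𝟙 M, by rw [reassoc_of% e₁, prod.lift_fst, Category.id_comp]⟩
      ⟨prod.fst, by rw [reassoc_of% e₂, prod.map_fst]⟩
    refine ⟨t, ?_, ?_⟩
    · have : prod.lift t (prod.snd ≫ prod.snd) ≫ prod.map i (𝟙 X) = hφ.lift _ _ hw := by
        ext
        · simp [ht]
        · rw [hφ.lift_fst]; simp
      conv_lhs => rw [hρ]
      rw [reassoc_of% this, hφ.lift_snd]
    · rw [← cancel_mono i, Category.assoc, ht, reassoc_of% e₁, prod.lift_fst, Category.id_comp]
  obtain ⟨ht, ht₁⟩ := ht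
  refine ⟨⟨fun g h hgh => ?_⟩, ⟨prod.lift 0 (𝟙 X), prod.lift_snd _ _, hρ₂⟩, ?_, ?_⟩
  · have hs : g ≫ prod.snd = h ≫ prod.snd := by simpa using hgh =≫ prod.fst
    have hr : g ≫ ρ = h ≫ ρ := by simpa using hgh =≫ prod.snd
    have : g ≫ prod.map i (𝟙 X) = h ≫ prod.map i (𝟙 X) := by
      apply hφ.hom_ext
      · simpa using hs
      · simpa [hρ] using hr
    ext
    · rw [← cancel_mono i]
      simpa using this =≫ prod.fst
    · exact hs
  · have e : prod.lift (𝟙 M) 0 ≫ prod.lift t prod.snd = prod.lift (𝟙 M) (0 : M ⟶ M ⨯ X) := by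
      apply prod.hom_ext
      · rw [Category.assoc, prod.lift_fst, prod.lift_fst, ht₁]
      · simp
    have : IsIso (prod.lift t prod.snd) := hC.isIso (q := prod.snd) _ (prod.lift_snd _ _)
      (isKernelOf_prod_snd M (M ⨯ X)) (by rw [e]; exact isKernelOf_prod_snd _ _)
    obtain ⟨b, hb⟩ : ∃ b : M ⨯ X ⟶ M ⨯ (M ⨯ X),
        b ≫ prod.lift t prod.snd = prod.lift 0 (𝟙 _) :=
      ⟨prod.lift 0 (𝟙 _) ≫ inv (prod.lift t prod.snd), by
        rw [Category.assoc, IsIso.inv_hom_id, Category.comp_id]⟩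
    have hb₁ : b ≫ t = 0 := by simpa using hb =≫ prod.fst
    have hb₂ : b ≫ prod.snd = 𝟙 _ := by simpa using hb =≫ prod.snd
    refine ⟨prod.lift (b ≫ prod.fst) ρ, prod.lift_snd _ _, ?_⟩
    have e₁ : prod.lift (b ≫ prod.fst) ρ = b ≫ prod.map (𝟙 M) ρ := by
      ext
      · simp
      · simp [reassoc_of% hb₂]
    have e₂ : b ≫ prod.lift t (prod.snd ≫ prod.snd) = prod.snd ≫ prod.lift 0 (𝟙 X) := by
      ext
      · simp [hb₁]
      · simp [reassoc_of% hb₂]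
    rw [e₁, Category.assoc, ← ht, reassoc_of% e₂, hρ₂, Category.comp_id]
  · refine ⟨prod.lift (pullback.snd _ _ ≫ prod.fst) (pullback.fst _ _) ≫
      prod.lift t (prod.snd ≫ prod.snd), by simp, ?_⟩
    have e : prod.lift (pullback.snd ρ prod.snd ≫ prod.fst) (pullback.fst ρ prod.snd) ≫
        prod.map (𝟙 M) ρ = pullback.snd ρ prod.snd := by
      ext
      · simp
      · simp [pullback.condition]
    rw [Category.assoc, ht, reassoc_of% e]

end Protomodularity

theorem isKernelOf_of_isKernelPair_action {C : Type u} [Category.{v} C] [HasZeroMorphisms C]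
    [HasFiniteLimits C] {M X Z : C} {m : M ⟶ X} [Mono m] {ρ : M ⨯ X ⟶ X}
    (h₁ : prod.lift (𝟙 M) 0 ≫ ρ = m) {g : X ⟶ Z} (hg : IsKernelPair g prod.snd ρ) :
    IsKernelOf m g := by
  refine isKernelOf_of_mono ?_ fun t ht => ?_
  · rw [← h₁, Category.assoc, ← hg.w, prod.lift_snd_assoc, zero_comp]
  · have hw : 0 ≫ g = t ≫ g := by rw [ht, zero_comp]
    have : hg.lift 0 t hw = (hg.lift 0 t hw ≫ prod.fst) ≫ prod.lift (𝟙 M) 0 := by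
      ext
      · simp
      · rw [hg.lift_fst]; simp
    exact ⟨hg.lift 0 t hw ≫ prod.fst, by rw [← h₁, ← Category.assoc, ← this, hg.lift_snd]⟩

/-- In a semi-abelian category, every subobject of the kernel of a central extension
is a normal monomorphism. -/
theorem statement5 {C : Type u} [Category.{v} C] [HasZeroMorphisms C] [HasZeroObject C]
    [HasFiniteLimits C] [HasBinaryCoproducts C] [SemiAbelian C]
    {K X Y : C} (f : X ⟶ Y) (k : K ⟶ X)
    (hk : IsKernelOf k f) (hf : IsCentralExt f)
    {M : C} (i : M ⟶ K) (hi : Mono i) :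
    IsNormalMonoP (i ≫ k) := by
  have hC : Protomodular C := SemiAbelian.protomodular
  have := hk.mono
  obtain ⟨l, hl⟩ : ∃ l, l ≫ kernel.ι f = k := ⟨kernel.lift f k hk.1, kernel.lift_ι _ _ _⟩
  obtain ⟨-, φ, hφ₁, hφ₂⟩ := hf
  have h₁ : prod.lift (𝟙 K) 0 ≫ prod.map l (𝟙 X) ≫ φ = k := by
    have : prod.lift (𝟙 K) (0 : K ⟶ X) ≫ prod.map l (𝟙 X) = l ≫ prod.lift (𝟙 _) 0 := by
      ext <;> simp
    rw [reassoc_of% this, hφ₁, hl]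
  have h₂ : prod.lift 0 (𝟙 X) ≫ prod.map l (𝟙 X) ≫ φ = 𝟙 X := by
    rw [prod.lift_map_assoc, zero_comp, Category.comp_id, hφ₂]
  obtain ⟨Z, g, hg⟩ := SemiAbelian.equivRelationEffective _ _
    (hC.isEquivRelation_action h₂ (hC.isKernelPair_action hk h₁ h₂) i)
  refine ⟨Z, g, isKernelOf_of_isKernelPair_action ?_ hg⟩
  have : prod.lift (𝟙 M) (0 : M ⟶ X) ≫ prod.map i (𝟙 X) = i ≫ prod.lift (𝟙 K) 0 := by
    ext <;> simp
  rw [reassoc_of% this, h₁]
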